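/- The center of the infinitesimal Hecke algebra H_z is a polynomial algebra in one variable, generated by an element t_z of filtration degree 2 whose leading term (in the associated graded algebra U(sl2 ⋉ V)) is ey² + hxy − fx². -/

import Mathlib

noncomputable section

open Polynomial

/-- Free algebra on generators e, h, f, x, y. -/
abbrev F5 : Type := FreeAlgebra ℂ (Fin 5)

def ge : F5 := FreeAlgebra.ι ℂ 0
def gh : F5 := FreeAlgebra.ι ℂ 1
def gf : F5 := FreeAlgebra.ι ℂ 2
def gx : F5 := FreeAlgebra.ι ℂ 3
def gy : F5 := FreeAlgebra.ι ℂ 4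

/-- The shifted Casimir element Δ = h² + 4ef − 2h (as a word in the free algebra). -/
def gΔ : F5 := gh * gh + 4 * (ge * gf) - 2 * gh

/-- Defining relations of the infinitesimal Hecke algebra H_z of sl₂:
sl₂ relations, the standard action on V = span(x,y), and [x,y] = z. -/
inductive HRel (z : F5) : F5 → F5 → Prop
  | he : HRel z (gh * ge) (ge * gh + 2 * ge)
  | hf : HRel z (gh * gf) (gf * gh - 2 * gf)
  | ef : HRel z (ge * gf) (gf * ge + gh)
  | ex : HRel z (ge * gx) (gx * ge)
  | ey : HRel z (ge * gy) (gy * ge + gx)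
  | fx : HRel z (gf * gx) (gx * gf + gy)
  | fy : HRel z (gf * gy) (gy * gf)
  | hx : HRel z (gh * gx) (gx * gh + gx)
  | hy : HRel z (gh * gy) (gy * gh - gy)
  | xy : HRel z (gx * gy) (gy * gx + z)

/-- The infinitesimal Hecke algebra H_z (for z = 0 this is U(sl₂ ⋉ V)). -/
abbrev Hz (z : F5) : Type := RingQuot (HRel z)

/-- Canonical projection from the free algebra. -/
def π (z : F5) : F5 →ₐ[ℂ] Hz z := RingQuot.mkAlgHom ℂ (HRel z)

noncomputable section
open Polynomial

lemma exists_anti (f : ℂ[X]) : ∃ k : ℂ[X], ∀ m : ℂ, k.eval (m+1) - k.eval m = f.eval m := by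
  induction f using Polynomial.induction_on' with
  | add f g hf hg =>
    obtain ⟨k, hk⟩ := hf
    obtain ⟨l, hl⟩ := hg
    refine ⟨k + l, fun m => ?_⟩
    simp only [eval_add, ← hk, ← hl]; ring
  | monomial n a =>
    refine ⟨C (a/(n+1)) * (Polynomial.bernoulli (n+1)).map (algebraMap ℚ ℂ), fun m => ?_⟩
    have h := congrArg (fun q : ℚ[X] => (q.map (algebraMap ℚ ℂ)).eval m)
      (Polynomial.bernoulli_comp_one_add_X (n+1))
    simp [Polynomial.map_comp] at h
    have hn : (n:ℂ)+1 ≠ 0 := by exact_mod_cast Nat.succ_ne_zero n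
    simp only [eval_mul, eval_C, eval_monomial]
    rw [add_comm m 1]
    simp only [eval_map_algebraMap, h]; field_simp; ring

lemma even_poly (G : ℂ[X]) (hG : ∀ m : ℂ, G.eval (-m) = G.eval m) :
    ∃ g : ℂ[X], ∀ m : ℂ, g.eval (m^2 - 1) = G.eval m := by
  have h1 : G.comp (C (-1) * X) = G := Polynomial.funext fun m => by simp [hG]
  have h2 : expand ℂ 2 (contract 2 G) = G := by
    ext n
    rw [coeff_expand (by norm_num)]
    split_ifs with h
    · rw [coeff_contract (by norm_num), Nat.div_mul_cancel h]
    · have h3 := congrArg (fun q => q.coeff n) h1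
      simp only [comp_C_mul_X_coeff] at h3
      have : Odd n := by rcases Nat.even_or_odd n with h' | h'; exact absurd h'.two_dvd h; exact h'
      rw [this.neg_one_pow] at h3
      have h4 : (2:ℂ) * G.coeff n = 0 := by linear_combination -h3
      exact (by simpa using h4 : G.coeff n = 0).symm
  refine ⟨(contract 2 G).comp (X + 1), fun m => ?_⟩
  conv_rhs => rw [← h2]
  simp [expand_eval]

lemma exists_kg (p : ℂ[X]) : ∃ k g : ℂ[X],
    (∀ m : ℂ, k.eval (m+1) - k.eval m = m * p.eval (m^2-1)) ∧
    ∀ m : ℂ, g.eval (m^2-1) = k.eval m + (m-1)/2 * p.eval (m^2-1) := by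
  obtain ⟨k, hk⟩ := exists_anti (X * p.comp (X^2-1))
  simp at hk
  have hs : ∀ m : ℂ, k.eval (-m) = k.eval (m+1) := by
    have h0 : ∀ n : ℕ, k.eval (-(n:ℂ)) = k.eval ((n:ℂ)+1) := by
      intro n
      induction n with
      | zero => have := hk 0; simp at this ⊢; linear_combination -this
      | succ n ih =>
        have h1 := hk (-(n:ℂ)-1)
        have h2 := hk ((n:ℂ)+1)
        rw [show -(n:ℂ)-1+1 = -n by ring, show (-(n:ℂ)-1)^2 = (n+1)^2 by ring] at h1
        push_cast
        rw [show -((n:ℂ)+1) = -n-1 by ring]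
        linear_combination ih - h1 - h2
    have h1 : k.comp (-X) = k.comp (X+1) := by
      apply Polynomial.eq_of_infinite_eval_eq
      refine Set.Infinite.mono (s := Set.range (fun n : ℕ => (n:ℂ))) ?_ 
        (Set.infinite_range_of_injective Nat.cast_injective)
      rintro _ ⟨n, rfl⟩
      simp [h0]
    intro m
    have := congrArg (fun q => q.eval m) h1
    simpa using this
  obtain ⟨g, hg⟩ := even_poly (k + C (1/2) * (X - 1) * p.comp (X^2-1)) (by
    intro m
    have := hk m
    simp [hs]
    linear_combination this)
  refine ⟨k, g, hk, fun m => ?_⟩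
  rw [hg]; simp only [eval_add, eval_mul, eval_C, eval_sub, eval_X, eval_one, eval_comp, eval_pow]; ring
end

noncomputable section
open Polynomial

/-- The representation space. -/
abbrev WW : Type := ℤ → ℤ → ℂ[X]

def mm (a : ℤ) : ℂ := a + 1/3
def hh (a b : ℤ) : ℂ := a + 2 * b

lemma mm_ne (a : ℤ) : mm a ≠ 0 := by
  intro h
  have h1 : (3 * a + 1 : ℂ) = 0 := by unfold mm at h; linear_combination 3 * h
  have h2 : (3 * a + 1 : ℤ) = 0 := by exact_mod_cast h1
  omega

def al (a : ℤ) : ℂ[X] := C ((mm a)⁻¹)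
def be (k : ℂ[X]) (a : ℤ) : ℂ[X] := C ((mm a)⁻¹) * (C (k.eval (mm a + 1)) - X)

def oe : Module.End ℂ WW where
  toFun φ := fun a b => φ a (b-1)
  map_add' _ _ := rfl
  map_smul' _ _ := rfl

def oh : Module.End ℂ WW where
  toFun φ := fun a b => C (hh a b) * φ a b
  map_add' _ _ := by funext a b; simp [mul_add]
  map_smul' _ _ := by funext a b; simp

def of : Module.End ℂ WW where
  toFun φ := fun a b => C ((mm a ^ 2 - (hh a b + 1)^2)/4) * φ a (b+1)
  map_add' _ _ := by funext a b; simp only [Pi.add_apply, mul_add]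
  map_smul' _ _ := by funext a b; simp only [Pi.smul_apply, mul_smul_comm, RingHom.id_apply]

def ox (k : ℂ[X]) : Module.End ℂ WW where
  toFun φ := fun a b => al a * φ (a-1) b + be k a * φ (a+1) (b-1)
  map_add' _ _ := by funext a b; simp only [Pi.add_apply]; ring
  map_smul' _ _ := by
    funext a b; simp only [Pi.smul_apply, mul_smul_comm, RingHom.id_apply, smul_add]

def oy (k : ℂ[X]) : Module.End ℂ WW where
  toFun φ := fun a b => C ((mm a - 1 - hh a b)/2) * al a * φ (a-1) (b+1)
    + C ((- mm a - 1 - hh a b)/2) * be k a * φ (a+1) b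
  map_add' _ _ := by funext a b; simp only [Pi.add_apply]; ring
  map_smul' _ _ := by
    funext a b; simp only [Pi.smul_apply, mul_smul_comm, RingHom.id_apply, smul_add]

lemma oe_apply (φ a b) : oe φ a b = φ a (b-1) := rfl
lemma oh_apply (φ a b) : oh φ a b = C (hh a b) * φ a b := rfl
lemma of_apply (φ a b) : of φ a b = C ((mm a ^ 2 - (hh a b + 1)^2)/4) * φ a (b+1) := rfl
lemma ox_apply (k φ a b) : ox k φ a b = al a * φ (a-1) b + be k a * φ (a+1) (b-1) := rfl
lemma oy_apply (k φ a b) : oy k φ a b = C ((mm a - 1 - hh a b)/2) * al a * φ (a-1) (b+1)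
    + C ((- mm a - 1 - hh a b)/2) * be k a * φ (a+1) b := rfl

lemma mm_add (a : ℤ) : mm (a+1) = mm a + 1 := by simp [mm]; ring
lemma mm_sub (a : ℤ) : mm (a-1) = mm a - 1 := by simp [mm]; ring
lemma hh_a_add (a b : ℤ) : hh (a+1) b = hh a b + 1 := by simp [hh]; ring
lemma hh_a_sub (a b : ℤ) : hh (a-1) b = hh a b - 1 := by simp [hh]; ring
lemma hh_b_add (a b : ℤ) : hh a (b+1) = hh a b + 2 := by simp [hh]; ring
lemma hh_b_sub (a b : ℤ) : hh a (b-1) = hh a b - 2 := by simp [hh]; ring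

lemma Ctwo : (2 : ℂ[X]) = C 2 := (map_ofNat C 2).symm
lemma Cfour : (4 : ℂ[X]) = C 4 := (map_ofNat C 4).symm

def oD : Module.End ℂ WW := oh * oh + 4 * (oe * of) - 2 * oh

lemma four_apply (φ : WW) (a b : ℤ) : (4 : Module.End ℂ WW) φ a b = 4 * φ a b := by
  have : (4 : Module.End ℂ WW) = algebraMap ℂ _ 4 := (map_ofNat (algebraMap ℂ (Module.End ℂ WW)) 4).symm
  rw [this, Module.algebraMap_end_apply]
  simp only [Pi.smul_apply, smul_eq_C_mul, Cfour]
lemma two_apply (φ : WW) (a b : ℤ) : (2 : Module.End ℂ WW) φ a b = 2 * φ a b := by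
  have : (2 : Module.End ℂ WW) = algebraMap ℂ _ 2 := (map_ofNat (algebraMap ℂ (Module.End ℂ WW)) 2).symm
  rw [this, Module.algebraMap_end_apply]
  simp only [Pi.smul_apply, smul_eq_C_mul, Ctwo]

lemma oD_apply (φ : WW) (a b : ℤ) : oD φ a b = C (mm a ^ 2 - 1) * φ a b := by
  simp only [oD, LinearMap.sub_apply, LinearMap.add_apply, Module.End.mul_apply, Pi.sub_apply,
    Pi.add_apply, four_apply, two_apply, oe_apply, oh_apply, of_apply, hh_b_sub, sub_add_cancel,
    Ctwo, Cfour, ← mul_assoc, ← C_mul, ← sub_mul, ← add_mul, ← C_sub, ← C_add]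
  congr 2; ring

lemma aeval_oD_apply (p : ℂ[X]) (φ : WW) (a b : ℤ) :
    aeval oD p φ a b = C (p.eval (mm a ^ 2 - 1)) * φ a b := by
  induction p using Polynomial.induction_on' generalizing φ with
  | add p q hp hq =>
    simp only [map_add, LinearMap.add_apply, Pi.add_apply, hp, hq, eval_add, add_mul]
  | monomial n c =>
    induction n generalizing φ with
    | zero => simp [smul_eq_C_mul]
    | succ n ih =>
      rw [← monomial_mul_X, map_mul, aeval_X, Module.End.mul_apply, ih, oD_apply, ← mul_assoc,
        ← C_mul]
      congr 2; simp only [eval_mul, eval_X, eval_monomial]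

def lift5 (k : ℂ[X]) : F5 →ₐ[ℂ] Module.End ℂ WW :=
  FreeAlgebra.lift ℂ ![oe, oh, of, ox k, oy k]

lemma lift_e (k) : lift5 k ge = oe := by simp [lift5, ge]
lemma lift_h (k) : lift5 k gh = oh := by simp [lift5, gh]
lemma lift_f (k) : lift5 k gf = of := by simp [lift5, gf]
lemma lift_x (k) : lift5 k gx = ox k := by simp [lift5, gx]
lemma lift_y (k) : lift5 k gy = oy k := by simp [lift5, gy]
lemma lift_D (k) : lift5 k gΔ = oD := by
  simp only [gΔ, oD, map_sub, map_add, map_mul, map_ofNat, lift_e, lift_h, lift_f]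
lemma lift_z (k p : ℂ[X]) : lift5 k (aeval gΔ p) = aeval oD p := by
  rw [← lift_D k, Polynomial.aeval_algHom_apply]

lemma rel_ok (p k : ℂ[X]) (hk : ∀ m : ℂ, k.eval (m+1) - k.eval m = m * p.eval (m^2-1))
    (u v : F5) (h : HRel (aeval gΔ p) u v) : lift5 k u = lift5 k v := by
  have key : ∀ a : ℤ, k.eval (mm a + 1) = k.eval (mm a) + mm a * p.eval (mm a^2-1) := fun a => by
    linear_combination hk (mm a)
  have hm := mm_ne
  cases h <;>
  · simp only [map_sub, map_add, map_mul, map_ofNat, lift_e, lift_h, lift_f, lift_x, lift_y, lift_z]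
    refine LinearMap.ext fun φ => funext fun a => funext fun b => ?_
    simp only [LinearMap.sub_apply, LinearMap.add_apply, Module.End.mul_apply, Pi.sub_apply,
      Pi.add_apply, two_apply, oe_apply, oh_apply, of_apply, ox_apply, oy_apply,
      hh_b_sub, hh_b_add, hh_a_add, hh_a_sub, mm_add, mm_sub, aeval_oD_apply,
      sub_add_cancel, add_sub_cancel_right]
    all_goals
      refine Polynomial.funext fun t => ?_
      have h1 := hm a
      have h2 := hm (a+1)
      have h3 := hm (a-1)
      rw [mm_add] at h2
      rw [mm_sub] at h3
      simp only [al, be, mm_add, mm_sub, eval_add, eval_sub, eval_mul, eval_C, eval_X, eval_ofNat,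
        sub_add_cancel, add_sub_cancel_right, key]
      field_simp
      ring

def rho (p k : ℂ[X]) (hk : ∀ m : ℂ, k.eval (m+1) - k.eval m = m * p.eval (m^2-1)) :
    Hz (aeval gΔ p) →ₐ[ℂ] Module.End ℂ WW :=
  RingQuot.liftAlgHom ℂ ⟨lift5 k, rel_ok p k hk⟩

section
variable (p k : ℂ[X]) (hk : ∀ m : ℂ, k.eval (m+1) - k.eval m = m * p.eval (m^2-1))

lemma rho_pi (w : F5) : rho p k hk (π (aeval gΔ p) w) = lift5 k w := by
  simp [rho, π]

/-- The central element. -/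
def TT (p g : ℂ[X]) : F5 := ge * gy^2 + gh * gx * gy - gf * gx^2
  + (aeval gΔ g - (algebraMap ℂ F5 (1/2)) * gh * aeval gΔ p)

lemma rho_T (g : ℂ[X])
    (hg : ∀ m : ℂ, g.eval (m^2-1) = k.eval m + (m-1)/2 * p.eval (m^2-1)) (φ : WW) (a b : ℤ) :
    rho p k hk (π (aeval gΔ p) (TT p g)) φ a b = X * φ a b := by
  have key : ∀ a : ℤ, k.eval (mm a + 1) = k.eval (mm a) + mm a * p.eval (mm a^2-1) := fun a => by
    linear_combination hk (mm a)
  have hm := mm_ne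
  simp only [rho_pi, TT, map_sub, map_add, map_mul, map_pow, lift_e, lift_h, lift_f, lift_x, lift_y,
    lift_z, AlgHom.commutes, pow_two]
  simp only [LinearMap.sub_apply, LinearMap.add_apply, Module.End.mul_apply, Pi.sub_apply,
      Module.algebraMap_end_apply, Pi.smul_apply, smul_eq_C_mul,
      Pi.add_apply, oe_apply, oh_apply, of_apply, ox_apply, oy_apply,
      hh_b_sub, hh_b_add, hh_a_add, hh_a_sub, mm_add, mm_sub, aeval_oD_apply,
      sub_add_cancel, add_sub_cancel_right]
  refine Polynomial.funext fun t => ?_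
  have h1 := hm a
  have h2 := hm (a+1)
  have h3 := hm (a-1)
  rw [mm_add] at h2
  rw [mm_sub] at h3
  simp only [al, be, mm_add, mm_sub, eval_add, eval_sub, eval_mul, eval_C, eval_X, 
      sub_add_cancel, key, hg]
  field_simp
  ring
end
end

noncomputable section
open Polynomial

section span
variable {A : Type*} [Ring A] [Algebra ℂ A] {e h f x y z : A}

def MU (e h f : A) : Submodule ℂ A :=
  Submodule.span ℂ (Set.range fun s : ℕ × ℕ × ℕ => e ^ s.1 * h ^ s.2.1 * f ^ s.2.2)

lemma MU_mem (e h f : A) (i j k : ℕ) : e ^ i * h ^ j * f ^ k ∈ MU e h f :=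
  Submodule.subset_span ⟨(i, j, k), rfl⟩

lemma MU_of (e h f c : A) (hc : ∀ i j k : ℕ, c * (e ^ i * h ^ j * f ^ k) ∈ MU e h f) :
    ∀ m ∈ MU e h f, c * m ∈ MU e h f := by
  intro m hm
  induction hm using Submodule.span_induction with
  | mem m hm => obtain ⟨⟨i, j, k⟩, rfl⟩ := hm; exact hc i j k
  | zero => simp
  | add a b _ _ ha hb => rw [mul_add]; exact add_mem ha hb
  | smul r a _ ha => rw [mul_smul_comm]; exact Submodule.smul_mem _ _ ha

lemma MU_e : ∀ m ∈ MU e h f, e * m ∈ MU e h f := MU_of _ _ _ _ fun i j k => by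
  have := MU_mem e h f (i+1) j k
  rwa [pow_succ', mul_assoc, mul_assoc, ← mul_assoc (e^i)] at this

lemma MU_h (he : h * e = e * h + 2 * e) : ∀ m ∈ MU e h f, h * m ∈ MU e h f :=
  MU_of _ _ _ _ fun i j k => by
  induction i with
  | zero =>
    have := MU_mem e h f 0 (j+1) k
    simpa [pow_succ', mul_assoc] using this
  | succ i ih =>
    have h1 : h * (e ^ (i+1) * h^j * f^k) = e * (h * (e^i * h^j * f^k))
        + (e * (e^i * h^j * f^k) + e * (e^i * h^j * f^k)) := by
      have : h * (e ^ (i+1) * h^j * f^k) = (h * e) * (e^i * h^j * f^k) := by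
        rw [pow_succ']; noncomm_ring
      rw [this, he]; noncomm_ring
    rw [h1]
    have h2 := MU_e _ (MU_mem e h f i j k)
    exact add_mem (MU_e _ ih) (add_mem h2 h2)

lemma MU_f (he : h * e = e * h + 2 * e) (hf : h * f = f * h - 2 * f) (ef : e * f = f * e + h) :
    ∀ m ∈ MU e h f, f * m ∈ MU e h f :=
  MU_of _ _ _ _ fun i j k => by
  induction i with
  | zero =>
    induction j with
    | zero => 
      have := MU_mem e h f 0 0 (k+1)
      simpa [pow_succ'] using this
    | succ j ih =>
      have h1 : f * (e ^ 0 * h^(j+1) * f^k) = h * (f * (e^0 * h^j * f^k))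
        + (f * (e^0 * h^j * f^k) + f * (e^0 * h^j * f^k)) := by
        have : f * (e ^ 0 * h^(j+1) * f^k) = (f * h) * (e^0 * h^j * f^k) := by
          rw [pow_succ']; noncomm_ring
        have h2 : f * h = h * f + 2 * f := by rw [hf]; noncomm_ring
        rw [this, h2]; noncomm_ring
      rw [h1]
      exact add_mem (MU_h he _ ih) (add_mem ih ih)
  | succ i ih =>
    have h1 : f * (e ^ (i+1) * h^j * f^k) = e * (f * (e^i * h^j * f^k))
        - h * (e^i * h^j * f^k) := by
      have : f * (e ^ (i+1) * h^j * f^k) = (f * e) * (e^i * h^j * f^k) := by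
        rw [pow_succ']; noncomm_ring
      have h2 : f * e = e * f - h := by rw [ef]; noncomm_ring
      rw [this, h2]; noncomm_ring
    rw [h1]
    exact sub_mem (MU_e _ ih) (MU_h he _ (MU_mem e h f i j k))

lemma U_le (he : h * e = e * h + 2 * e) (hf : h * f = f * h - 2 * f) (ef : e * f = f * e + h)
    (u : A) (hu : u ∈ Algebra.adjoin ℂ ({e, h, f} : Set A)) : u ∈ MU e h f := by
  have : ∀ m ∈ MU e h f, u * m ∈ MU e h f := by
    induction hu using Algebra.adjoin_induction with
    | mem u hu =>
      rcases hu with rfl | rfl | rfl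
      exacts [MU_e, MU_h he, MU_f he hf ef]
    | algebraMap r =>
      intro m hm
      rw [← Algebra.smul_def]; exact Submodule.smul_mem _ _ hm
    | add a b _ _ ha hb =>
      intro m hm; rw [add_mul]; exact add_mem (ha m hm) (hb m hm)
    | mul a b _ _ ha hb =>
      intro m hm; rw [mul_assoc]; exact ha _ (hb m hm)
  have h1 := this 1 (by simpa using MU_mem e h f 0 0 0)
  simpa using h1

lemma VU (ex : e * x = x * e) (ey : e * y = y * e + x) (fx : f * x = x * f + y) (fy : f * y = y * f)
    (hx : h * x = x * h + x) (hy : h * y = y * h - y)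
    (u : A) (hu : u ∈ Algebra.adjoin ℂ ({e, h, f} : Set A)) :
    (∃ u1 ∈ Algebra.adjoin ℂ ({e, h, f} : Set A), ∃ u2 ∈ Algebra.adjoin ℂ ({e, h, f} : Set A),
      x * u = u1 * x + u2 * y) ∧
    (∃ u1 ∈ Algebra.adjoin ℂ ({e, h, f} : Set A), ∃ u2 ∈ Algebra.adjoin ℂ ({e, h, f} : Set A),
      y * u = u1 * x + u2 * y) := by
  induction hu using Algebra.adjoin_induction with
  | mem u hu =>
    have me : e ∈ Algebra.adjoin ℂ ({e, h, f} : Set A) := Algebra.subset_adjoin (by simp)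
    have mh : h ∈ Algebra.adjoin ℂ ({e, h, f} : Set A) := Algebra.subset_adjoin (by simp)
    have mf : f ∈ Algebra.adjoin ℂ ({e, h, f} : Set A) := Algebra.subset_adjoin (by simp)
    rcases hu with rfl | rfl | rfl
    · exact ⟨⟨u, me, 0, zero_mem _, by rw [ex]; noncomm_ring⟩,
        ⟨-1, neg_mem (one_mem _), u, me, by rw [ey]; noncomm_ring⟩⟩
    · exact ⟨⟨u - 1, sub_mem mh (one_mem _), 0, zero_mem _, by rw [sub_mul, hx]; noncomm_ring⟩,
        ⟨0, zero_mem _, u + 1, add_mem mh (one_mem _), by rw [add_mul, hy]; noncomm_ring⟩⟩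
    · exact ⟨⟨u, mf, -1, neg_mem (one_mem _), by rw [fx]; noncomm_ring⟩,
        ⟨0, zero_mem _, u, mf, by rw [fy]; noncomm_ring⟩⟩
  | algebraMap r =>
    exact ⟨⟨_, algebraMap_mem _ r, 0, zero_mem _, by rw [Algebra.commutes]; simp⟩,
      ⟨0, zero_mem _, _, algebraMap_mem _ r, by rw [Algebra.commutes]; simp⟩⟩
  | add a b _ _ ha hb =>
    obtain ⟨⟨a1, ha1, a2, ha2, h1⟩, ⟨a3, ha3, a4, ha4, h2⟩⟩ := ha
    obtain ⟨⟨b1, hb1, b2, hb2, h3⟩, ⟨b3, hb3, b4, hb4, h4⟩⟩ := hb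
    refine ⟨⟨a1 + b1, add_mem ha1 hb1, a2 + b2, add_mem ha2 hb2, ?_⟩,
      ⟨a3 + b3, add_mem ha3 hb3, a4 + b4, add_mem ha4 hb4, ?_⟩⟩
    · rw [mul_add, h1, h3]; noncomm_ring
    · rw [mul_add, h2, h4]; noncomm_ring
  | mul a b _ _ ha hb =>
    obtain ⟨⟨a1, ha1, a2, ha2, h1⟩, ⟨a3, ha3, a4, ha4, h2⟩⟩ := ha
    obtain ⟨⟨b1, hb1, b2, hb2, h3⟩, ⟨b3, hb3, b4, hb4, h4⟩⟩ := hb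
    refine ⟨⟨a1 * b1 + a2 * b3, add_mem (mul_mem ha1 hb1) (mul_mem ha2 hb3),
      a1 * b2 + a2 * b4, add_mem (mul_mem ha1 hb2) (mul_mem ha2 hb4), ?_⟩,
      ⟨a3 * b1 + a4 * b3, add_mem (mul_mem ha3 hb1) (mul_mem ha4 hb3),
      a3 * b2 + a4 * b4, add_mem (mul_mem ha3 hb2) (mul_mem ha4 hb4), ?_⟩⟩
    · rw [← mul_assoc, h1, add_mul, mul_assoc, mul_assoc, h3, h4]; noncomm_ring
    · rw [← mul_assoc, h2, add_mul, mul_assoc, mul_assoc, h3, h4]; noncomm_ring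

def SN (e h f x y : A) (N : ℕ) : Submodule ℂ A :=
  Submodule.span ℂ {r | ∃ u ∈ Algebra.adjoin ℂ ({e, h, f} : Set A), ∃ l n : ℕ, l + n < N ∧
    r = u * x ^ l * y ^ n}

lemma SN_mono {N M : ℕ} (hN : N ≤ M) : SN e h f x y N ≤ SN e h f x y M :=
  Submodule.span_mono fun _ ⟨u, hu, l, n, hl, hr⟩ => ⟨u, hu, l, n, by omega, hr⟩

lemma SN_mem {N l n : ℕ} (hl : l + n < N) {u : A}
    (hu : u ∈ Algebra.adjoin ℂ ({e, h, f} : Set A)) : u * x^l * y^n ∈ SN e h f x y N :=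
  Submodule.subset_span ⟨u, hu, l, n, hl, rfl⟩

lemma SN_U {N : ℕ} {u : A} (hu : u ∈ Algebra.adjoin ℂ ({e, h, f} : Set A)) :
    ∀ s ∈ SN e h f x y N, u * s ∈ SN e h f x y N := by
  intro s hs
  induction hs using Submodule.span_induction with
  | mem m hm =>
    obtain ⟨v, hv, l, n, hl, rfl⟩ := hm
    rw [← mul_assoc, ← mul_assoc]
    exact SN_mem hl (mul_mem hu hv)
  | zero => simp
  | add a b _ _ ha hb => rw [mul_add]; exact add_mem ha hb
  | smul r a _ ha => rw [mul_smul_comm]; exact Submodule.smul_mem _ _ ha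

lemma SN_V (ex : e * x = x * e) (ey : e * y = y * e + x) (fx : f * x = x * f + y)
    (fy : f * y = y * f) (hx : h * x = x * h + x) (hy : h * y = y * h - y)
    (xy : x * y = y * x + z) (hz : z ∈ Algebra.adjoin ℂ ({e, h, f} : Set A)) (N : ℕ) :
    ∀ s ∈ SN e h f x y N, x * s ∈ SN e h f x y (N+1) ∧ y * s ∈ SN e h f x y (N+1) := by
  induction N using Nat.strong_induction_on with
  | _ N IH =>
  have cl : ∀ l n : ℕ, l + n < N → y * x^l * y^n - x^l * y^(n+1) ∈ SN e h f x y (l+n) := by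
    intro l n hl
    induction l with
    | zero => simp [pow_succ']
    | succ l ih =>
      have h1 : y * x^(l+1) * y^n - x^(l+1) * y^(n+1) =
          x * (y * x^l * y^n - x^l * y^(n+1)) - z * x^l * y^n := by
        have h2 : y * x^(l+1) * y^n = (y * x) * (x^l * y^n) := by
          rw [pow_succ']; noncomm_ring
        have h3 : y * x = x * y - z := by rw [xy]; noncomm_ring
        rw [h2, h3, pow_succ' x]; noncomm_ring
      rw [h1, show l + 1 + n = l + n + 1 by omega]
      exact sub_mem (IH (l+n) (by omega) _ (ih (by omega))).1 (SN_mem (by omega) hz)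
  have cl2 : ∀ l n : ℕ, l + n < N → ∀ u1 ∈ Algebra.adjoin ℂ ({e, h, f} : Set A),
      ∀ u2 ∈ Algebra.adjoin ℂ ({e, h, f} : Set A), 
      (u1 * x + u2 * y) * (x^l * y^n) ∈ SN e h f x y (N+1) := by
    intro l n hl u1 h1 u2 h2
    have : (u1 * x + u2 * y) * (x^l * y^n) = u1 * x^(l+1) * y^n +
        (u2 * (y * x^l * y^n - x^l * y^(n+1)) + u2 * x^l * y^(n+1)) := by
      rw [pow_succ' x]; noncomm_ring
    rw [this]
    exact add_mem (SN_mem (by omega) h1) (add_mem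
      (SN_U h2 _ (SN_mono (by omega) (cl l n hl))) (SN_mem (by omega) h2))
  intro s hs
  induction hs using Submodule.span_induction with
  | mem m hm =>
    obtain ⟨v, hv, l, n, hl, rfl⟩ := hm
    obtain ⟨⟨a1, ha1, a2, ha2, h1⟩, ⟨a3, ha3, a4, ha4, h2⟩⟩ := VU ex ey fx fy hx hy v hv
    rw [mul_assoc v, ← mul_assoc x, ← mul_assoc y, h1, h2]
    exact ⟨cl2 l n hl _ ha1 _ ha2, cl2 l n hl _ ha3 _ ha4⟩
  | zero => simp
  | add a b _ _ ha hb =>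
    rw [mul_add, mul_add]; exact ⟨add_mem ha.1 hb.1, add_mem ha.2 hb.2⟩
  | smul r a _ ha =>
    rw [mul_smul_comm, mul_smul_comm]
    exact ⟨Submodule.smul_mem _ _ ha.1, Submodule.smul_mem _ _ ha.2⟩

/-- normal form map -/
def nf (e h f x y : A) : MvPolynomial (Fin 5) ℂ →ₗ[ℂ] A :=
  (MvPolynomial.basisMonomials (Fin 5) ℂ).constr ℂ
    (fun s => e ^ s 0 * h ^ s 1 * f ^ s 2 * x ^ s 3 * y ^ s 4)

lemma nf_monomial (s : Fin 5 →₀ ℕ) :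
    nf e h f x y (MvPolynomial.monomial s 1) = e ^ s 0 * h ^ s 1 * f ^ s 2 * x ^ s 3 * y ^ s 4 := by
  have h1 : (MvPolynomial.monomial s 1 : MvPolynomial (Fin 5) ℂ)
      = MvPolynomial.basisMonomials (Fin 5) ℂ s := by rw [MvPolynomial.coe_basisMonomials]
  rw [nf, h1, Module.Basis.constr_basis]

lemma SN_nf (he : h * e = e * h + 2 * e) (hf : h * f = f * h - 2 * f) (ef : e * f = f * e + h)
    (N : ℕ) : SN e h f x y N ≤ LinearMap.range (nf e h f x y) := by
  refine Submodule.span_le.2 ?_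
  rintro _ ⟨u, hu, l, n, -, rfl⟩
  have := U_le he hf ef u hu
  clear hu
  show u * x^l * y^n ∈ LinearMap.range (nf e h f x y)
  induction this using Submodule.span_induction with
  | mem m hm =>
    obtain ⟨⟨i, j, k⟩, rfl⟩ := hm
    refine ⟨MvPolynomial.monomial (Finsupp.equivFunOnFinite.symm ![i, j, k, l, n]) 1, ?_⟩
    rw [nf_monomial]; simp
  | zero => simp
  | add a b h1 h2 ha hb =>
    rw [add_mul, add_mul]
    exact add_mem ha hb
  | smul r a h1 ha =>
    rw [smul_mul_assoc, smul_mul_assoc]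
    exact Submodule.smul_mem _ _ ha
end span

lemma pi_D (z : F5) : π z gΔ = π z gh * π z gh + 4 * (π z ge * π z gf) - 2 * π z gh := by
  simp only [gΔ, map_sub, map_add, map_mul, map_ofNat]

section
variable (p : ℂ[X])

local notation "zz" => (aeval gΔ p : F5)
local notation "qe" => π (aeval gΔ p) ge
local notation "qh" => π (aeval gΔ p) gh
local notation "qf" => π (aeval gΔ p) gf
local notation "qx" => π (aeval gΔ p) gx
local notation "qy" => π (aeval gΔ p) gy

lemma pi_rel {u v : F5} (h : HRel zz u v) : π zz u = π zz v := RingQuot.mkAlgHom_rel ℂ h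

lemma aeval_mem (q : ℂ[X]) : π zz (aeval gΔ q) ∈ Algebra.adjoin ℂ ({qe, qh, qf} : Set (Hz zz)) := by
  rw [← Polynomial.aeval_algHom_apply]
  have me : qe ∈ Algebra.adjoin ℂ ({qe, qh, qf} : Set (Hz zz)) := Algebra.subset_adjoin (by simp)
  have mh : qh ∈ Algebra.adjoin ℂ ({qe, qh, qf} : Set (Hz zz)) := Algebra.subset_adjoin (by simp)
  have mf : qf ∈ Algebra.adjoin ℂ ({qe, qh, qf} : Set (Hz zz)) := Algebra.subset_adjoin (by simp)
  have : π zz gΔ ∈ Algebra.adjoin ℂ ({qe, qh, qf} : Set (Hz zz)) := by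
    rw [pi_D]
    exact sub_mem (add_mem (mul_mem mh mh) (mul_mem (ofNat_mem _ 4) (mul_mem me mf)))
      (mul_mem (ofNat_mem _ 2) mh)
  exact Algebra.adjoin_le (by simpa using this) (Polynomial.aeval_mem_adjoin_singleton ℂ _)

lemma nf_surj : Function.Surjective (nf qe qh qf qx qy) := by
  have re := pi_rel p HRel.he
  have rf := pi_rel p HRel.hf
  have ref := pi_rel p HRel.ef
  have rex := pi_rel p HRel.ex
  have rey := pi_rel p HRel.ey
  have rfx := pi_rel p HRel.fx
  have rfy := pi_rel p HRel.fy
  have rhx := pi_rel p HRel.hx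
  have rhy := pi_rel p HRel.hy
  have rxy := pi_rel p HRel.xy
  simp only [map_add, map_sub, map_mul, map_ofNat] at re rf ref rex rey rfx rfy rhx rhy rxy
  have me : qe ∈ Algebra.adjoin ℂ ({qe, qh, qf} : Set (Hz zz)) := Algebra.subset_adjoin (by simp)
  have mh : qh ∈ Algebra.adjoin ℂ ({qe, qh, qf} : Set (Hz zz)) := Algebra.subset_adjoin (by simp)
  have mf : qf ∈ Algebra.adjoin ℂ ({qe, qh, qf} : Set (Hz zz)) := Algebra.subset_adjoin (by simp)
  have hV := SN_V rex rey rfx rfy rhx rhy rxy (aeval_mem p p)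
  have key : ∀ w : F5, ∀ N, ∀ s ∈ SN qe qh qf qx qy N, ∃ M, π zz w * s ∈ SN qe qh qf qx qy M := by
    intro w
    induction w using FreeAlgebra.induction with
    | grade0 r =>
      intro N s hs
      refine ⟨N, ?_⟩
      rw [AlgHom.commutes, ← Algebra.smul_def]
      exact Submodule.smul_mem _ _ hs
    | grade1 i =>
      intro N s hs
      refine ⟨N+1, ?_⟩
      fin_cases i
      · exact SN_mono (Nat.le_succ N) (SN_U me s hs)
      · exact SN_mono (Nat.le_succ N) (SN_U mh s hs)
      · exact SN_mono (Nat.le_succ N) (SN_U mf s hs)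
      · exact (hV N s hs).1
      · exact (hV N s hs).2
    | mul a b ha hb =>
      intro N s hs
      obtain ⟨M, hM⟩ := hb N s hs
      obtain ⟨L, hL⟩ := ha M _ hM
      exact ⟨L, by rwa [map_mul, mul_assoc]⟩
    | add a b ha hb =>
      intro N s hs
      obtain ⟨M, hM⟩ := hb N s hs
      obtain ⟨L, hL⟩ := ha N s hs
      refine ⟨max M L, ?_⟩
      rw [map_add, add_mul]
      exact add_mem (SN_mono (le_max_right _ _) hL) (SN_mono (le_max_left _ _) hM)
  intro r
  obtain ⟨w, rfl⟩ := RingQuot.mkAlgHom_surjective ℂ (HRel zz) r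
  have h1 : (1 : Hz zz) ∈ SN qe qh qf qx qy 1 := by
    have := SN_mem (e := qe) (h := qh) (f := qf) (x := qx) (y := qy) (N := 1) (l := 0) (n := 0)
      (by norm_num) (one_mem _)
    simpa using this
  obtain ⟨M, hM⟩ := key w 1 1 h1
  rw [mul_one] at hM
  exact SN_nf re rf ref M hM
end
end

noncomputable section
open Polynomial Filter Topology

def ll (μ : ℂ) (n : ℕ) : ℂ := (n + 1) / μ
def Pn (s : ℕ) (μ P : ℂ) (n : ℕ) : ℂ := P / ll μ n ^ (s+1)
def NN (s : ℕ) (μ P Q : ℂ) (n : ℕ) (a b : ℤ) : ℂ := Pn s μ P n ^ (-a) * Q ^ (-b)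
def tn (s : ℕ) (μ τ : ℂ) (n : ℕ) : ℂ := -τ * (ll μ n ^ (s+1))^2

/-- `ψ n`, rescaled around the moving base point, converges to the constant `c`. -/
def Lim (s : ℕ) (μ τ P Q : ℂ) (j : ℤ) (ψ : ℕ → WW) (d : ℕ) (c : ℂ) : Prop :=
  ∀ a b : ℤ, Tendsto (fun n : ℕ => (ll μ n ^ d)⁻¹ * NN s μ P Q n a b *
    (ψ n (n + a) (j * n + b)).eval (tn s μ τ n)) atTop (𝓝 c)

section
variable {s : ℕ} {μ τ P Q : ℂ} {j : ℤ} (hμ : μ ≠ 0) (hP : P ≠ 0) (hQ : Q ≠ 0)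

include hμ in
lemma ll_ne (n : ℕ) : ll μ n ≠ 0 := div_ne_zero (by exact_mod_cast Nat.succ_ne_zero n) hμ

include hμ hP in
lemma Pn_ne (n : ℕ) : Pn s μ P n ≠ 0 := div_ne_zero hP (pow_ne_zero _ (ll_ne hμ n))

lemma ll_inv_tendsto : Tendsto (fun n => (ll μ n)⁻¹) atTop (𝓝 0) := by
  have h := (tendsto_one_div_add_atTop_nhds_zero_nat (𝕜 := ℂ)).const_mul μ
  rw [mul_zero] at h
  refine h.congr fun n => ?_
  simp [ll, div_eq_mul_inv]

include hμ in
lemma lin_tendsto (α β : ℂ) : Tendsto (fun n : ℕ => (α * n + β) * (ll μ n)⁻¹) atTop (𝓝 (α * μ)) := by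
  have h := ((ll_inv_tendsto (μ := μ)).const_mul (β - α)).add_const (α * μ)
  rw [mul_zero, zero_add] at h
  refine h.congr fun n => ?_
  have : (n:ℂ) + 1 ≠ 0 := by exact_mod_cast Nat.succ_ne_zero n
  simp only [ll]; field_simp; ring

include hμ in
lemma mm_tendsto (a : ℤ) : Tendsto (fun n : ℕ => mm (n + a) * (ll μ n)⁻¹) atTop (𝓝 μ) := by
  have := lin_tendsto hμ 1 (a + 1/3)
  rw [one_mul] at this
  refine this.congr fun n => ?_
  simp [mm]; left; ring

include hμ in
lemma mm_inv_tendsto (a : ℤ) : Tendsto (fun n : ℕ => ll μ n * (mm (n + a))⁻¹) atTop (𝓝 μ⁻¹) := by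
  refine ((mm_tendsto hμ a).inv₀ hμ).congr fun n => ?_
  rw [mul_inv, inv_inv, mul_comm]

include hμ in
lemma hh_tendsto (a b : ℤ) : Tendsto (fun n : ℕ => hh (n + a) (j * n + b) * (ll μ n)⁻¹) atTop
    (𝓝 ((1 + 2 * j) * μ)) := by
  refine (lin_tendsto hμ (1 + 2 * j) (a + 2 * b)).congr fun n => ?_
  simp [hh]; left; ring

include hμ in
lemma k_tendsto (k : ℂ[X]) (hs : k.natDegree ≤ s) (a : ℤ) :
    Tendsto (fun n : ℕ => k.eval (mm (n + a) + 1) * ((ll μ n ^ (s+1))⁻¹)^2) atTop (𝓝 0) := by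
  have h1 : ∀ n : ℕ, k.eval (mm (n + a) + 1) * ((ll μ n ^ (s+1))⁻¹)^2 =
      ∑ i ∈ Finset.range (k.natDegree + 1), k.coeff i * (mm (n + (a + 1)) * (ll μ n)⁻¹)^i *
        ((ll μ n)⁻¹)^(2*s+2 - i) := by
    intro n
    rw [eval_eq_sum_range, Finset.sum_mul]
    refine Finset.sum_congr rfl fun i hi => ?_
    rw [Finset.mem_range] at hi
    rw [← mm_add, add_assoc, mul_pow, mul_assoc, mul_assoc, mul_assoc, ← pow_add,
      show i + (2*s+2-i) = (s+1)*2 by omega, pow_mul]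
    simp only [inv_pow]
  simp_rw [h1]
  rw [show (0:ℂ) = ∑ i ∈ Finset.range (k.natDegree + 1), k.coeff i * μ^i * 0 by simp]
  refine tendsto_finsetSum _ fun i hi => ?_
  rw [Finset.mem_range] at hi
  refine (((mm_tendsto hμ (a+1)).pow i).const_mul _).mul ?_
  have := (ll_inv_tendsto (μ := μ)).pow (2*s+2-i)
  rwa [zero_pow (by omega)] at this

variable {ψ : ℕ → WW} {d : ℕ} {c : ℂ}

include hμ hP in
lemma NN_a_sub (n : ℕ) (a b : ℤ) : NN s μ P Q n a b = NN s μ P Q n (a-1) b * (Pn s μ P n)⁻¹ := by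
  unfold NN
  rw [show -a = -(a-1) + -1 by ring, zpow_add₀ (Pn_ne hμ hP n), zpow_neg_one]; ring

include hμ hP in
lemma NN_a_add (n : ℕ) (a b : ℤ) : NN s μ P Q n a b = NN s μ P Q n (a+1) b * Pn s μ P n := by
  unfold NN
  rw [show -a = -(a+1) + 1 by ring, zpow_add₀ (Pn_ne hμ hP n), zpow_one]; ring

include hQ in
lemma NN_b_sub (n : ℕ) (a b : ℤ) : NN s μ P Q n a b = NN s μ P Q n a (b-1) * Q⁻¹ := by
  unfold NN
  rw [show -b = -(b-1) + -1 by ring, zpow_add₀ hQ, zpow_neg_one]; ring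

include hQ in
lemma NN_b_add (n : ℕ) (a b : ℤ) : NN s μ P Q n a b = NN s μ P Q n a (b+1) * Q := by
  unfold NN
  rw [show -b = -(b+1) + 1 by ring, zpow_add₀ hQ, zpow_one]; ring

include hQ in
lemma Lim_e (H : Lim s μ τ P Q j ψ d c) : Lim s μ τ P Q j (fun n => oe (ψ n)) d (c * Q⁻¹) := by
  intro a b
  refine ((H a (b-1)).mul_const Q⁻¹).congr fun n => ?_
  beta_reduce
  rw [NN_b_sub hQ n a b, oe_apply, add_sub_assoc]; ring

include hμ in
lemma Lim_h (H : Lim s μ τ P Q j ψ d c) :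
    Lim s μ τ P Q j (fun n => oh (ψ n)) (d+1) (c * ((1 + 2*j) * μ)) := by
  intro a b
  refine ((H a b).mul (hh_tendsto hμ a b)).congr fun n => ?_
  beta_reduce
  rw [oh_apply, eval_mul, eval_C, pow_succ, mul_inv]; ring

include hμ hQ in
lemma Lim_f (H : Lim s μ τ P Q j ψ d c) :
    Lim s μ τ P Q j (fun n => of (ψ n)) (d+2) (c * ((μ^2 - ((1 + 2*j) * μ)^2)/4 * Q)) := by
  intro a b
  have h1 := (((mm_tendsto hμ a).pow 2).sub
    (((hh_tendsto (j := j) hμ a b).add (ll_inv_tendsto (μ := μ))).pow 2)).div_const 4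
  rw [add_zero] at h1
  refine ((H a (b+1)).mul (h1.mul_const Q)).congr fun n => ?_
  beta_reduce
  rw [of_apply, eval_mul, eval_C, pow_add, mul_inv, NN_b_add hQ n a b, add_assoc (j * (n:ℤ))]; ring

include hμ hP hQ in
lemma Lim_x (k : ℂ[X]) (hs : k.natDegree ≤ s) (H : Lim s μ τ P Q j ψ d c) :
    Lim s μ τ P Q j (fun n => ox k (ψ n)) (d+s) (c * ((P⁻¹ + P * τ * Q⁻¹) * μ⁻¹)) := by
  intro a b
  have h1 := (H (a-1) b).mul ((mm_inv_tendsto hμ a).const_mul P⁻¹)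
  have h2 := (H (a+1) (b-1)).mul ((((k_tendsto hμ k hs a).add_const τ).const_mul (P * Q⁻¹)).mul
    (mm_inv_tendsto hμ a))
  have h3 := h1.add h2
  rw [show c * (P⁻¹ * μ⁻¹) + c * (P * Q⁻¹ * (0 + τ) * μ⁻¹)
    = c * ((P⁻¹ + P * τ * Q⁻¹) * μ⁻¹) by ring] at h3
  refine h3.congr fun n => ?_
  beta_reduce
  rw [ox_apply, eval_add, add_sub_assoc, add_assoc (n:ℤ), add_sub_assoc]
  refine Eq.trans ?_ (mul_add _ _ _).symm
  have hl := ll_ne hμ n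
  have hm := mm_ne (n + a)
  congr 1
  · rw [NN_a_sub hμ hP n a b]
    simp only [al, eval_mul, eval_C, Pn]
    field_simp
    ring
  · rw [NN_a_add hμ hP n a b, NN_b_sub hQ n (a+1) b]
    simp only [be, eval_mul, eval_C, Pn, tn, eval_sub, eval_X]
    field_simp
    ring

include hμ hP hQ in
lemma Lim_y (k : ℂ[X]) (hs : k.natDegree ≤ s) (H : Lim s μ τ P Q j ψ d c) :
    Lim s μ τ P Q j (fun n => oy k (ψ n)) (d+(s+1))
      (c * (((μ - (1 + 2*j)*μ)/2 * P⁻¹ * Q + (-μ - (1+2*j)*μ)/2 * P * τ) * μ⁻¹)) := by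
  intro a b
  have g1 := (((mm_tendsto hμ a).sub (ll_inv_tendsto (μ := μ))).sub
    (hh_tendsto (j := j) hμ a b)).div_const 2
  have g2 := (((mm_tendsto hμ a).neg.sub (ll_inv_tendsto (μ := μ))).sub
    (hh_tendsto (j := j) hμ a b)).div_const 2
  have h1 := (H (a-1) (b+1)).mul ((g1.mul (mm_inv_tendsto hμ a)).const_mul (P⁻¹ * Q))
  have h2 := (H (a+1) b).mul (g2.mul ((((k_tendsto hμ k hs a).add_const τ).const_mul P).mul
    (mm_inv_tendsto hμ a)))
  have h3 := h1.add h2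
  have e1 : c * (P⁻¹ * Q * ((μ - 0 - (1 + 2*j)*μ)/2 * μ⁻¹)) +
      c * ((-μ - 0 - (1+2*j)*μ)/2 * (P * (0 + τ) * μ⁻¹))
    = c * (((μ - (1 + 2*j)*μ)/2 * P⁻¹ * Q + (-μ - (1+2*j)*μ)/2 * P * τ) * μ⁻¹) := by ring
  rw [e1] at h3
  refine h3.congr fun n => ?_
  beta_reduce
  rw [oy_apply, eval_add, add_sub_assoc (n:ℤ), add_assoc (n:ℤ), add_assoc (j * (n:ℤ))]
  refine Eq.trans ?_ (mul_add _ _ _).symm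
  have hl := ll_ne hμ n
  have hm := mm_ne (n + a)
  congr 1
  · rw [NN_a_sub hμ hP n a b, NN_b_add hQ n (a-1) b]
    simp only [al, eval_mul, eval_C, Pn]
    field_simp
    try ring
  · rw [NN_a_add hμ hP n a b]
    simp only [be, eval_mul, eval_C, Pn, tn, eval_sub, eval_X]
    field_simp
    try ring

lemma Lim_pow (O : Module.End ℂ WW) (dg : ℕ) (σ : ℂ)
    (HO : ∀ (ψ : ℕ → WW) (d : ℕ) (c : ℂ), Lim s μ τ P Q j ψ d c →
      Lim s μ τ P Q j (fun n => O (ψ n)) (d+dg) (c * σ)) (i : ℕ)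
    (ψ : ℕ → WW) (d : ℕ) (c : ℂ) (H : Lim s μ τ P Q j ψ d c) :
      Lim s μ τ P Q j (fun n => (O^i) (ψ n)) (d+i*dg) (c * σ^i) := by
  induction i with
  | zero => simpa using H
  | succ i ih =>
    have := HO _ _ _ ih
    simp only [pow_succ', Module.End.mul_apply]
    rwa [show d + (i+1)*dg = d + i * dg + dg by ring, show c * (σ * σ^i) = c * σ^i * σ by ring]

def testf (s : ℕ) (μ P Q : ℂ) (j : ℤ) (n : ℕ) : WW :=
  fun a b => C (Pn s μ P n ^ (a - n) * Q ^ (b - j * n))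

include hμ hP hQ in
lemma Lim_test : Lim s μ τ P Q j (testf s μ P Q j) 0 1 := by
  intro a b
  refine tendsto_const_nhds.congr fun n => ?_
  have h1 := Pn_ne (s := s) hμ hP n
  simp only [testf, eval_C, NN, add_sub_cancel_left, zpow_neg]
  field_simp
  try simp

def wt (s : ℕ) (v : Fin 5 →₀ ℕ) : ℕ := 0 + v 4 * (s+1) + v 3 * s + v 2 * 2 + v 1 * 1 + v 0 * 0

/-- The vector of symbols. -/
def sig (μ η τ P Q : ℂ) : Fin 5 → ℂ :=
  ![Q⁻¹, η, (μ^2 - η^2)/4 * Q, (P⁻¹ + P * τ * Q⁻¹) * μ⁻¹,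
    ((μ - η)/2 * P⁻¹ * Q + (-μ - η)/2 * P * τ) * μ⁻¹]

include hμ hP hQ in
lemma Lim_mono (k : ℂ[X]) (hs : k.natDegree ≤ s) (v : Fin 5 →₀ ℕ) :
    Lim s μ τ P Q j (fun n => (nf oe oh of (ox k) (oy k) (MvPolynomial.monomial v 1))
      (testf s μ P Q j n)) (wt s v) (∏ i, sig μ ((1+2*j)*μ) τ P Q i ^ v i) := by
  have h0 := Lim_test (s := s) (τ := τ) (j := j) hμ hP hQ
  have h1 := Lim_pow (oy k) _ _ (fun _ _ _ H => Lim_y hμ hP hQ k hs H) (v 4) _ _ _ h0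
  have h2 := Lim_pow (ox k) _ _ (fun _ _ _ H => Lim_x hμ hP hQ k hs H) (v 3) _ _ _ h1
  have h3 := Lim_pow of _ _ (fun _ _ _ H => Lim_f hμ hQ H) (v 2) _ _ _ h2
  have h4 := Lim_pow oh _ _ (fun _ _ _ H => Lim_h hμ H) (v 1) _ _ _ h3
  have h5 := Lim_pow oe 0 _ (fun _ _ _ H => Lim_e hQ H) (v 0) _ _ _ h4
  simp only [nf_monomial, Module.End.mul_apply]
  convert h5 using 1
  · rfl
  · rw [Fin.prod_univ_five]; simp [sig]; ring

/-- top part -/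
def top (s : ℕ) (D : ℕ) (G : MvPolynomial (Fin 5) ℂ) : MvPolynomial (Fin 5) ℂ :=
  ∑ v ∈ G.support, if wt s v = D then MvPolynomial.monomial v (G.coeff v) else 0

include hμ hP hQ in
lemma top_zero (k : ℂ[X]) (hs : k.natDegree ≤ s) (G : MvPolynomial (Fin 5) ℂ)
    (hG : nf oe oh of (ox k) (oy k) G = 0) (D : ℕ) (hD : ∀ v ∈ G.support, wt s v ≤ D) :
    MvPolynomial.eval (sig μ ((1+2*j)*μ) τ P Q) (top s D G) = 0 := by
  have h1 : Tendsto (fun n : ℕ => ∑ v ∈ G.support, G.coeff v * ((ll μ n)⁻¹ ^ (D - wt s v) *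
      ((ll μ n ^ (wt s v))⁻¹ * NN s μ P Q n 0 0 *
    ((nf oe oh of (ox k) (oy k) (MvPolynomial.monomial v 1))
      (testf s μ P Q j n) (n + 0) (j * n + 0)).eval (tn s μ τ n)))) atTop
      (𝓝 (MvPolynomial.eval (sig μ ((1+2*j)*μ) τ P Q) (top s D G))) := by
    rw [top, map_sum]
    refine tendsto_finsetSum _ fun v hv => ?_
    have h2 := Lim_mono (s := s) (τ := τ) (j := j) hμ hP hQ k hs v 0 0
    split_ifs with hw
    · rw [MvPolynomial.eval_monomial, Finsupp.prod_fintype _ _ (by simp)]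
      refine (h2.const_mul _).congr fun n => ?_
      rw [hw]; simp
    · rw [map_zero]
      have h3 := (ll_inv_tendsto (μ := μ)).pow (D - wt s v)
      have := hD v hv
      rw [zero_pow (by omega)] at h3
      have h4 := (h3.mul h2).const_mul (G.coeff v)
      rwa [zero_mul, mul_zero] at h4
  refine tendsto_nhds_unique h1 (tendsto_const_nhds.congr fun n => ?_)
  have h2 : ∀ φ : WW, ∀ a b : ℤ, ∀ t : ℂ, ∑ v ∈ G.support, G.coeff v *
      ((nf oe oh of (ox k) (oy k) (MvPolynomial.monomial v 1)) φ a b).eval t = 0 := by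
    intro φ a b t
    have h3 := congrArg (fun O : Module.End ℂ WW => (O φ a b).eval t) hG
    rw [G.as_sum, map_sum] at h3
    simp only [LinearMap.zero_apply, Pi.zero_apply, eval_zero, LinearMap.sum_apply,
      Finset.sum_apply, eval_finsetSum] at h3
    rw [← h3]
    refine Finset.sum_congr rfl fun v _ => ?_
    rw [show MvPolynomial.monomial v (G.coeff v) = G.coeff v • MvPolynomial.monomial v (1:ℂ) by
      rw [MvPolynomial.smul_monomial, smul_eq_mul, mul_one], map_smul]
    simp
  have h3 := h2 (testf s μ P Q j n) (n+0) (j*n+0) (tn s μ τ n)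
  have hl := ll_ne hμ n
  rw [← mul_zero ((ll μ n ^ D)⁻¹ * NN s μ P Q n 0 0), ← h3, Finset.mul_sum]
  refine Finset.sum_congr rfl fun v hv => ?_
  have e1 : ll μ n ^ D = ll μ n ^ (D - wt s v) * ll μ n ^ (wt s v) := by
    rw [← pow_add, Nat.sub_add_cancel (hD v hv)]
  rw [e1, mul_inv, inv_pow]; ring
end
end

noncomputable section
open Polynomial

lemma sig_all_eta (Gt : MvPolynomial (Fin 5) ℂ) (μ τ P Q : ℂ) (hμ : μ ≠ 0)
    (h : ∀ j : ℤ, MvPolynomial.eval (sig μ ((1+2*j)*μ) τ P Q) Gt = 0) (η : ℂ) :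
    MvPolynomial.eval (sig μ η τ P Q) Gt = 0 := by
  set w : Fin 5 → ℂ[X] := ![C Q⁻¹, X, (C (μ^2) - X^2) * C (Q/4), C ((P⁻¹ + P * τ * Q⁻¹) * μ⁻¹),
    ((C μ - X) * C (P⁻¹ * Q / 2) + (- C μ - X) * C (P * τ / 2)) * C μ⁻¹] with hw
  have key : ∀ η : ℂ, MvPolynomial.eval (sig μ η τ P Q) Gt = (MvPolynomial.aeval w Gt).eval η := by
    intro η
    have := MvPolynomial.comp_aeval_apply (R := ℂ) w (Polynomial.aeval η : ℂ[X] →ₐ[ℂ] ℂ) Gt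
    rw [Polynomial.coe_aeval_eq_eval] at this
    rw [this, ← MvPolynomial.coe_aeval_eq_eval]
    have e : sig μ η τ P Q = fun i => eval η (w i) := by
      funext i
      fin_cases i <;> simp [sig, hw] <;> first | ring1 | (left; ring1)
    rw [e]; rfl
  have hz : MvPolynomial.aeval w Gt = 0 := by
    apply Polynomial.eq_zero_of_infinite_isRoot
    have hinj : Function.Injective (fun j : ℤ => (1 + 2 * (j:ℂ)) * μ) := by
      intro i j hij
      have h1 := mul_right_cancel₀ hμ hij
      have h2 : (i:ℂ) = j := by linear_combination h1 / 2
      exact_mod_cast h2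
    refine (Set.infinite_range_of_injective hinj).mono ?_
    rintro _ ⟨j, rfl⟩
    show _ = _
    rw [← key]; exact h j
  rw [key, hz, eval_zero]

lemma sig_vanish (Gt : MvPolynomial (Fin 5) ℂ)
    (h : ∀ (μ τ P Q : ℂ) (j : ℤ), μ ≠ 0 → P ≠ 0 → Q ≠ 0 →
      MvPolynomial.eval (sig μ ((1+2*j)*μ) τ P Q) Gt = 0) : Gt = 0 := by
  have hpt : ∀ v : Fin 5 → ℂ, v 0 ≠ 0 → 4 * v 0 * v 2 + v 1 ^ 2 ≠ 0 →
      v 0 * v 4 ^ 2 + v 1 * v 3 * v 4 - v 2 * v 3 ^ 2 ≠ 0 → MvPolynomial.eval v Gt = 0 := by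
    intro v h0 h1 h2
    obtain ⟨μ, hμ⟩ := IsAlgClosed.exists_pow_nat_eq (4 * v 0 * v 2 + v 1 ^ 2) (n := 2) (by norm_num)
    have hμ0 : μ ≠ 0 := by rintro rfl; apply h1; rw [← hμ]; norm_num
    set A := v 4 * v 0 + (μ + v 1) / 2 * v 3 with hA
    have hA0 : A ≠ 0 := by
      intro hA'
      have : A * (v 4 * v 0 + (v 1 - μ) / 2 * v 3) =
          v 0 * (v 0 * v 4 ^ 2 + v 1 * v 3 * v 4 - v 2 * v 3 ^ 2) := by
        rw [hA]; linear_combination (-(v 3)^2/4) * hμ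
      rw [hA', zero_mul] at this
      exact mul_ne_zero h0 h2 this.symm
    have := sig_all_eta Gt μ ((v 3 * μ - A) / v 0 * A) A⁻¹ (v 0)⁻¹ hμ0
      (fun j => h μ _ _ _ j hμ0 (inv_ne_zero hA0) (inv_ne_zero h0)) (v 1)
    have e : sig μ (v 1) ((v 3 * μ - A) / v 0 * A) A⁻¹ (v 0)⁻¹ = v := by
      funext i
      fin_cases i
      · simp [sig]
      · simp [sig]
      · simp [sig, hμ]; field_simp
      · simp [sig]; field_simp; ring
      · simp [sig]; field_simp; rw [hA]; ring
    rwa [e] at this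
  set R : MvPolynomial (Fin 5) ℂ := MvPolynomial.X 0 * (4 * MvPolynomial.X 0 * MvPolynomial.X 2
    + MvPolynomial.X 1 ^ 2) * (MvPolynomial.X 0 * MvPolynomial.X 4 ^ 2 + MvPolynomial.X 1 *
      MvPolynomial.X 3 * MvPolynomial.X 4 - MvPolynomial.X 2 * MvPolynomial.X 3 ^ 2) with hR
  have hR0 : R ≠ 0 := by
    intro h0
    have := congrArg (MvPolynomial.eval ![1,1,0,1,1]) h0
    simp [hR] at this
  have hmul : Gt * R = 0 := by
    apply MvPolynomial.funext
    intro v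
    rw [map_mul, map_zero]
    by_cases hv : MvPolynomial.eval v R = 0
    · rw [hv, mul_zero]
    · rw [hR] at hv
      simp only [map_mul, map_add, map_sub, map_pow, MvPolynomial.eval_X, map_ofNat] at hv
      rw [hpt v (fun h => hv (by rw [h]; ring)) (fun h => hv (by rw [h]; ring))
        (fun h => hv (by rw [h]; ring)), zero_mul]
  exact (mul_eq_zero.mp hmul).resolve_right hR0

lemma nf_faithful (k : ℂ[X]) (G : MvPolynomial (Fin 5) ℂ)
    (hG : nf oe oh of (ox k) (oy k) G = 0) : G = 0 := by
  by_contra hne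
  obtain ⟨v, hv, hmax⟩ := Finset.exists_max_image G.support (wt k.natDegree)
    (MvPolynomial.support_nonempty.mpr hne)
  have h1 : top k.natDegree (wt k.natDegree v) G = 0 :=
    sig_vanish _ fun μ τ P Q j hμ hP hQ => top_zero hμ hP hQ k le_rfl G hG _ hmax
  have h2 : (top k.natDegree (wt k.natDegree v) G).coeff v = G.coeff v := by
    rw [top, MvPolynomial.coeff_sum, Finset.sum_eq_single v]
    · simp
    · intro w _ hw
      split_ifs <;> simp [MvPolynomial.coeff_monomial, hw]
    · intro h; exact absurd hv h
  rw [h1, MvPolynomial.coeff_zero] at h2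
  exact (MvPolynomial.mem_support_iff.mp hv) h2.symm

section
variable (p k : ℂ[X]) (hk : ∀ m : ℂ, k.eval (m+1) - k.eval m = m * p.eval (m^2-1))

lemma rho_nf (G : MvPolynomial (Fin 5) ℂ) :
    rho p k hk (nf (π (aeval gΔ p) ge) (π (aeval gΔ p) gh) (π (aeval gΔ p) gf) (π (aeval gΔ p) gx)
      (π (aeval gΔ p) gy) G) = nf oe oh of (ox k) (oy k) G := by
  rw [G.as_sum, map_sum, map_sum, map_sum]
  refine Finset.sum_congr rfl fun v _ => ?_
  rw [show MvPolynomial.monomial v (G.coeff v) = G.coeff v • MvPolynomial.monomial v (1:ℂ) by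
      rw [MvPolynomial.smul_monomial, smul_eq_mul, mul_one], map_smul, map_smul, map_smul,
      nf_monomial, nf_monomial]
  simp only [map_mul, map_pow, rho_pi, lift_e, lift_h, lift_f, lift_x, lift_y]

lemma rho_inj (r : Hz (aeval gΔ p)) (h : rho p k hk r = 0) : r = 0 := by
  obtain ⟨G, rfl⟩ := nf_surj p r
  rw [rho_nf] at h
  rw [nf_faithful k G h, map_zero]

lemma rho_inj' (r s : Hz (aeval gΔ p)) (h : rho p k hk r = rho p k hk s) : r = s :=
  sub_eq_zero.mp (rho_inj p k hk _ (by rw [map_sub, h, sub_self]))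

/-- multiplication by a polynomial -/
def smulq (q : ℂ[X]) (φ : WW) : WW := fun a b => q * φ a b

lemma lift_smulq (w : F5) : ∀ (q : ℂ[X]) (φ : WW), lift5 k w (smulq q φ) = smulq q (lift5 k w φ) := by
  induction w using FreeAlgebra.induction with
  | grade0 c =>
    intro q φ
    funext a b
    simp [smulq, Module.algebraMap_end_apply]
  | grade1 i =>
    intro q φ
    funext a b
    fin_cases i <;> simp [lift5, smulq, oe_apply, oh_apply, of_apply, ox_apply, oy_apply] <;> ring
  | mul u v hu hv =>
    intro q φ
    simp only [map_mul, Module.End.mul_apply, hu, hv]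
  | add u v hu hv =>
    intro q φ
    simp only [map_add, LinearMap.add_apply, hu, hv]
    funext a b
    simp [smulq, mul_add]

lemma pi_surj (z : F5) : Function.Surjective (π z) := RingQuot.mkAlgHom_surjective ℂ _

lemma rho_smulq (r : Hz (aeval gΔ p)) (q : ℂ[X]) (φ : WW) :
    rho p k hk r (smulq q φ) = smulq q (rho p k hk r φ) := by
  obtain ⟨w, rfl⟩ := pi_surj _ r
  rw [rho_pi, lift_smulq]

lemma lift_local (w : F5) : ∃ N : ℕ, ∀ (φ : WW) (a b : ℤ),
    (∀ a' b' : ℤ, |a' - a| ≤ N → |b' - b| ≤ N → φ a' b' = 0) → lift5 k w φ a b = 0 := by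
  induction w using FreeAlgebra.induction with
  | grade0 c =>
    refine ⟨0, fun φ a b h => ?_⟩
    have := h a b (by simp) (by simp)
    simp [Module.algebraMap_end_apply, this]
  | grade1 i =>
    refine ⟨1, fun φ a b h => ?_⟩
    have h1 := h a (b-1) (by simp) (by simp)
    have h2 := h a b (by simp) (by simp)
    have h3 := h a (b+1) (by simp) (by simp)
    have h4 := h (a-1) b (by simp) (by simp)
    have h5 := h (a+1) (b-1) (by simp) (by simp)
    have h6 := h (a-1) (b+1) (by simp) (by simp)
    have h7 := h (a+1) b (by simp) (by simp)
    fin_cases i <;> simp [lift5, oe_apply, oh_apply, of_apply, ox_apply, oy_apply, *]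
  | mul u v hu hv =>
    obtain ⟨N, hN⟩ := hu
    obtain ⟨M, hM⟩ := hv
    refine ⟨N + M, fun φ a b h => ?_⟩
    rw [map_mul, Module.End.mul_apply]
    refine hN _ _ _ fun a' b' ha hb => hM _ _ _ fun a'' b'' ha' hb' => h _ _ ?_ ?_
    · push_cast; rw [abs_le] at *; constructor <;> linarith [ha.1, ha.2, ha'.1, ha'.2]
    · push_cast; rw [abs_le] at *; constructor <;> linarith [hb.1, hb.2, hb'.1, hb'.2]
  | add u v hu hv =>
    obtain ⟨N, hN⟩ := hu
    obtain ⟨M, hM⟩ := hv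
    refine ⟨N + M, fun φ a b h => ?_⟩
    rw [map_add, LinearMap.add_apply, Pi.add_apply, Pi.add_apply,
      hN φ a b fun a' b' ha hb => h _ _ ?_ ?_, hM φ a b fun a' b' ha hb => h _ _ ?_ ?_, add_zero]
    all_goals push_cast; linarith [Int.natCast_nonneg N, Int.natCast_nonneg M]

def dl (a b : ℤ) : WW := fun a' b' => if a' = a ∧ b' = b then 1 else 0

lemma rho_zero_of_dl (r : Hz (aeval gΔ p)) (h : ∀ a b, rho p k hk r (dl a b) = 0) : r = 0 := by
  apply rho_inj p k hk
  obtain ⟨w, rfl⟩ := pi_surj _ r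
  obtain ⟨N, hN⟩ := lift_local k w
  refine LinearMap.ext fun φ => funext fun a => funext fun b => ?_
  set ψ : WW := ∑ c ∈ Finset.Icc (a - N) (a + N), ∑ d ∈ Finset.Icc (b - N) (b + N),
    smulq (φ c d) (dl c d) with hψ
  have h1 : rho p k hk (π _ w) ψ = 0 := by
    rw [hψ, map_sum]
    refine Finset.sum_eq_zero fun c _ => ?_
    rw [map_sum]
    refine Finset.sum_eq_zero fun d _ => ?_
    rw [rho_smulq, h]
    funext x y; simp [smulq]
  have h2 : rho p k hk (π _ w) (φ - ψ) a b = 0 := by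
    rw [rho_pi]
    apply hN
    intro a' b' ha hb
    rw [abs_le] at ha hb
    have : ψ a' b' = φ a' b' := by
      simp only [hψ, Finset.sum_apply, smulq, dl, mul_ite, mul_one, mul_zero]
      rw [Finset.sum_eq_single a', Finset.sum_eq_single b']
      · simp
      · intro d _ hd; rw [if_neg]; rintro ⟨_, h⟩; exact hd h.symm
      · intro hd; exact absurd (Finset.mem_Icc.mpr ⟨by linarith, by linarith⟩) hd
      · intro c _ hc; refine Finset.sum_eq_zero fun d _ => ?_
        rw [if_neg]; rintro ⟨h, _⟩; exact hc h.symm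
      · intro hd; exact absurd (Finset.mem_Icc.mpr ⟨by linarith, by linarith⟩) hd
    simp [this]
  rw [map_sub, h1, sub_zero] at h2
  simpa using h2

section
variable (g : ℂ[X]) (hg : ∀ m : ℂ, g.eval (m^2-1) = k.eval m + (m-1)/2 * p.eval (m^2-1))

include hk hg in
lemma T_central : π (aeval gΔ p) (TT p g) ∈ Subalgebra.center ℂ (Hz (aeval gΔ p)) := by
  rw [Subalgebra.mem_center_iff]
  intro r
  apply rho_inj' p k hk
  rw [map_mul, map_mul]
  have h : ∀ φ, rho p k hk (π (aeval gΔ p) (TT p g)) φ = smulq X φ := fun φ => by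
    funext a b; rw [rho_T p k hk g hg]; rfl
  refine LinearMap.ext fun φ => ?_
  rw [Module.End.mul_apply, Module.End.mul_apply, h, h, rho_smulq]

include hg in
lemma rho_aeval_T (q : ℂ[X]) (φ : WW) :
    rho p k hk (aeval (π (aeval gΔ p) (TT p g)) q) φ = smulq q φ := by
  rw [← Polynomial.aeval_algHom_apply]
  induction q using Polynomial.induction_on' generalizing φ with
  | add p q hp hq =>
    rw [map_add, LinearMap.add_apply, hp, hq]; funext a b; simp [smulq, add_mul]
  | monomial n c =>
    induction n generalizing φ with
    | zero => funext a b; simp [smulq, smul_eq_C_mul]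
    | succ n ih =>
      rw [← monomial_mul_X, map_mul, aeval_X, Module.End.mul_apply, ih]
      funext a b
      simp only [smulq, rho_T p k hk g hg, mul_assoc]

include hk hg in
lemma aeval_T_inj : Function.Injective
    (aeval (π (aeval gΔ p) (TT p g)) : ℂ[X] →ₐ[ℂ] Hz (aeval gΔ p)) := by
  intro q q' h
  have h1 := rho_aeval_T p k hk g hg q (dl 0 0)
  rw [h, rho_aeval_T p k hk g hg] at h1
  have h2 := congrFun (congrFun h1 0) 0
  simpa [smulq, dl] using h2.symm

lemma mm_sq_inj (a a' : ℤ) (h : mm a ^ 2 = mm a' ^ 2) : a = a' := by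
  rcases sq_eq_sq_iff_eq_or_eq_neg.mp h with h | h
  · have : (a:ℂ) = a' := by unfold mm at h; linear_combination h
    exact_mod_cast this
  · exfalso
    have : (3 * a + 3 * a' + 2 : ℂ) = 0 := by unfold mm at h; linear_combination 3 * h
    have h2 : (3 * a + 3 * a' + 2 : ℤ) = 0 := by exact_mod_cast this
    omega

include hk hg in
lemma center_le (c : Hz (aeval gΔ p)) (hc : c ∈ Subalgebra.center ℂ (Hz (aeval gΔ p))) :
    c ∈ Algebra.adjoin ℂ {π (aeval gΔ p) (TT p g)} := by
  rw [Subalgebra.mem_center_iff] at hc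
  have hcom : ∀ (w : F5) (φ : WW), lift5 k w (rho p k hk c φ) = rho p k hk c (lift5 k w φ) := by
    intro w φ
    have := congrArg (rho p k hk) (hc (π _ w))
    rw [map_mul, map_mul, rho_pi] at this
    exact LinearMap.congr_fun this φ
  set O := rho p k hk c with hO
  -- diagonal
  have hC : ∀ (x : ℂ) (φ : WW), O (smulq (C x) φ) = smulq (C x) (O φ) := fun x φ =>
    rho_smulq p k hk c (C x) φ
  have hdiag : ∀ a b : ℤ, O (dl a b) = smulq (O (dl a b) a b) (dl a b) := by
    intro a b
    funext a' b'
    by_cases ha : a' = a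
    · by_cases hb : b' = b
      · subst ha hb; simp [smulq, dl]
      · have h1 := hcom gh (dl a b)
        rw [lift_h, show oh (dl a b) = smulq (C (hh a b)) (dl a b) by
          funext x y
          by_cases hxy : x = a ∧ y = b
          · obtain ⟨rfl, rfl⟩ := hxy; rfl
          · simp [oh_apply, smulq, dl, hxy], hC] at h1
        have h2 := congrFun (congrFun h1 a') b'
        rw [oh_apply] at h2
        simp only [smulq] at h2
        have h3 : (C (hh a' b' - hh a b)) * O (dl a b) a' b' = 0 := by
          rw [C_sub, sub_mul, h2, sub_self]
        have h4 := (mul_eq_zero.mp h3).resolve_left (by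
          intro h
          rw [C_eq_zero] at h
          apply hb
          have : (b':ℂ) = b := by subst ha; unfold hh at h; linear_combination h / 2
          exact_mod_cast this)
        rw [h4]; simp [smulq, dl, hb]
    · have h1 := hcom gΔ (dl a b)
      rw [lift_D, show oD (dl a b) = smulq (C (mm a ^ 2 - 1)) (dl a b) by
        funext x y
        by_cases hxy : x = a ∧ y = b
        · obtain ⟨rfl, rfl⟩ := hxy; rw [oD_apply]; rfl
        · simp [oD_apply, smulq, dl, hxy], hC] at h1
      have h2 := congrFun (congrFun h1 a') b'
      rw [oD_apply] at h2
      simp only [smulq] at h2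
      have h3 : (C (mm a' ^ 2 - mm a ^ 2)) * O (dl a b) a' b' = 0 := by
        rw [show mm a' ^ 2 - mm a ^ 2 = (mm a' ^ 2 - 1) - (mm a ^ 2 - 1) by ring, C_sub, sub_mul,
          h2, sub_self]
      have h4 := (mul_eq_zero.mp h3).resolve_left (by
        intro h
        rw [C_eq_zero] at h
        exact ha (mm_sq_inj _ _ (sub_eq_zero.mp h)))
      rw [h4]; simp [smulq, dl, ha]
  set Q : ℤ → ℤ → ℂ[X] := fun a b => O (dl a b) a b with hQ
  have hdiag' : ∀ a b : ℤ, O (dl a b) = smulq (Q a b) (dl a b) := hdiag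
  have hb : ∀ a b : ℤ, Q a (b+1) = Q a b := by
    intro a b
    have h1 := hcom ge (dl a b)
    rw [lift_e, show oe (dl a b) = dl a (b+1) by
      funext x y; simp [oe_apply, dl, sub_eq_iff_eq_add], hdiag', hdiag'] at h1
    have h2 := congrFun (congrFun h1 a) (b+1)
    rw [oe_apply] at h2
    simpa [smulq, dl] using h2.symm
  have hx : ∀ a b : ℤ, ox k (dl a b) = smulq (al (a+1)) (dl (a+1) b) +
      smulq (be k (a-1)) (dl (a-1) (b+1)) := by
    intro a b
    funext x y
    simp only [ox_apply, smulq, dl, Pi.add_apply]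
    congr 1
    · by_cases h : x = a+1 ∧ y = b
      · obtain ⟨rfl, rfl⟩ := h; simp
      · rw [if_neg h, if_neg (by rintro ⟨h1, h2⟩; exact h ⟨by omega, h2⟩)]; simp
    · by_cases h : x = a-1 ∧ y = b+1
      · obtain ⟨rfl, rfl⟩ := h; simp
      · rw [if_neg h, if_neg (by rintro ⟨h1, h2⟩; exact h ⟨by omega, by omega⟩)]; simp
  have ha : ∀ a b : ℤ, Q (a+1) b = Q a b := by
    intro a b
    have h1 := hcom gx (dl a b)
    rw [lift_x, hx, hdiag', map_add, hO, rho_smulq, rho_smulq, ← hO, hdiag', hdiag'] at h1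
    have h2 := congrFun (congrFun h1 (a+1)) b
    rw [ox_apply] at h2
    have h5 : a + 1 ≠ a - 1 := by omega
    have h6 : a + 1 + 1 ≠ a := by omega
    simp [smulq, dl, h5, h6] at h2
    rcases h2 with h2 | h2
    · exact h2.symm
    · exfalso
      rw [al, C_eq_zero] at h2
      exact inv_ne_zero (mm_ne _) h2
  have hconst : ∀ a b : ℤ, Q a b = Q 0 0 := by
    have h1 : ∀ a b : ℤ, Q a b = Q a 0 := by
      intro a b
      induction b using Int.induction_on with
      | zero => rfl
      | succ i ih => rw [hb, ih]
      | pred i ih => rw [← ih, ← hb a (-i - 1), sub_add_cancel]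
    intro a b
    rw [h1]
    induction a using Int.induction_on with
    | zero => rfl
    | succ i ih => rw [ha, ih]
    | pred i ih => rw [← ih, ← ha (-i - 1), sub_add_cancel]
  have hfin : c = aeval (π (aeval gΔ p) (TT p g)) (Q 0 0) := by
    rw [← sub_eq_zero]
    apply rho_zero_of_dl p k hk
    intro a b
    rw [map_sub, LinearMap.sub_apply, rho_aeval_T p k hk g hg, ← hO, hdiag', hconst, sub_self]
  rw [hfin]
  exact Polynomial.aeval_mem_adjoin_singleton ℂ _
end
end
end

/-- The center of H_z is a polynomial algebra in one variable, generated by an element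
of filtration degree 2 whose leading term in gr(H_z) = U(sl₂ ⋉ V) is ey² + hxy − fx²
(i.e. the generator differs from ey² + hxy − fx² by an element of U(sl₂) ⊂ H_z). -/
theorem center_Hz_polynomial (p : Polynomial ℂ) :
    let z : F5 := Polynomial.aeval gΔ p
    ∃ T : Hz z,
      Subalgebra.center ℂ (Hz z) = Algebra.adjoin ℂ {T} ∧
      Function.Injective (Polynomial.aeval T : Polynomial ℂ →ₐ[ℂ] Hz z) ∧
      ∃ u ∈ Algebra.adjoin ℂ ({π z ge, π z gh, π z gf} : Set (Hz z)),
        T = π z ge * π z gy ^ 2 + π z gh * π z gx * π z gy - π z gf * π z gx ^ 2 + u := by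
  intro z
  obtain ⟨k, g, hk, hg⟩ := exists_kg p
  refine ⟨π z (TT p g), le_antisymm (fun c hc => center_le p k hk g hg c hc) ?_,
    aeval_T_inj p k hk g hg,
    π z (Polynomial.aeval gΔ g) - algebraMap ℂ (Hz z) (1/2) * π z gh * π z (Polynomial.aeval gΔ p), ?_, ?_⟩
  · rw [Algebra.adjoin_le_iff, Set.singleton_subset_iff]
    exact T_central p k hk g hg
  · refine sub_mem (aeval_mem p g) (mul_mem (mul_mem (Subalgebra.algebraMap_mem _ _) ?_)
      (aeval_mem p p))
    exact Algebra.subset_adjoin (by simp)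
  · simp only [TT, map_add, map_sub, map_mul, map_pow, AlgHom.commutes]
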